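/- Under the exploration assumption, let λ ≥ 0 and let π ∈ Π satisfy ‖log π − log π_λ‖_∞ ≤ ε (the maximum over (s,a) of |log π(a|s) − log π_λ(a|s)|). Then the gradient estimator ∇̃D(λ) := (U_{g₁}^π(ρ) − b₁, …, U_{g_n}^π(ρ) − b_n) satisfies ‖∇̃D(λ) − ∇D(λ)‖₂ ≤ √n·|A|·ε/(1−γ)². -/

import Mathlib

open scoped BigOperators

section CMDP

variable {S A : Type} [Fintype S] [Fintype A]

/-- `P` is a transition kernel: each `P s a` is a probability distribution over states. -/
def IsKernel (P : S → A → S → ℝ) : Prop :=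
  (∀ s a s', 0 ≤ P s a s') ∧ ∀ s a, ∑ s', P s a s' = 1

/-- `ρ` is a probability distribution over states. -/
def IsDist (ρ : S → ℝ) : Prop := (∀ s, 0 ≤ ρ s) ∧ ∑ s, ρ s = 1

/-- `π` is a (stationary, stochastic) policy. -/
def IsPolicy (π : S → A → ℝ) : Prop := (∀ s a, 0 ≤ π s a) ∧ ∀ s, ∑ a, π s a = 1

/-- One step of the state-action distribution dynamics under kernel `P` and policy `π`. -/
noncomputable def stepDist (P : S → A → S → ℝ) (π : S → A → ℝ) (μ : S → A → ℝ) :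
    S → A → ℝ :=
  fun s a => (∑ s', ∑ a', μ s' a' * P s' a' s) * π s a

/-- State-action distribution at time `t` of the Markov chain induced by `π`,
with initial state-action distribution `μ₀`. -/
noncomputable def trajSA (P : S → A → S → ℝ) (π : S → A → ℝ) (μ₀ : S → A → ℝ) :
    ℕ → S → A → ℝ
  | 0 => μ₀
  | (t + 1) => stepDist P π (trajSA P π μ₀ t)

/-- Initial state-action distribution when `s₀ ∼ ρ`, `a₀ ∼ π(·|s₀)`. -/
noncomputable def initSA (ρ : S → ℝ) (π : S → A → ℝ) : S → A → ℝ := fun s a => ρ s * π s a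

/-- Initial state-action distribution that is a Dirac at `(s₀, a₀)`. -/
noncomputable def diracSA [DecidableEq S] [DecidableEq A] (s₀ : S) (a₀ : A) : S → A → ℝ :=
  fun s a => if s = s₀ ∧ a = a₀ then 1 else 0

/-- Expected discounted cumulative value `E[∑ γ^t c(s_t,a_t)]` with initial
state-action distribution `μ₀`. -/
noncomputable def dsum (γ : ℝ) (P : S → A → S → ℝ) (π : S → A → ℝ) (μ₀ : S → A → ℝ)
    (c : S → A → ℝ) : ℝ :=
  ∑' t : ℕ, γ ^ t * ∑ s, ∑ a, trajSA P π μ₀ t s a * c s a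

/-- Value function `V^π(ρ)` (for reward/utility `c`). -/
noncomputable def Vval (γ : ℝ) (P : S → A → S → ℝ) (π : S → A → ℝ) (ρ : S → ℝ)
    (c : S → A → ℝ) : ℝ := dsum γ P π (initSA ρ π) c

/-- Q-function `Q^π(s,a)` (for reward/utility `c`). -/
noncomputable def Qval [DecidableEq S] [DecidableEq A] (γ : ℝ) (P : S → A → S → ℝ)
    (π : S → A → ℝ) (s : S) (a : A) (c : S → A → ℝ) : ℝ :=
  dsum γ P π (diracSA s a) c

/-- Discounted state visitation distribution `d_ρ^π(s)`. -/
noncomputable def visit (γ : ℝ) (P : S → A → S → ℝ) (π : S → A → ℝ) (ρ : S → ℝ)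
    (s : S) : ℝ :=
  (1 - γ) * ∑' t : ℕ, γ ^ t * ∑ a, trajSA P π (initSA ρ π) t s a

/-- Discounted entropy `H(ρ, π)`. -/
noncomputable def Hent (γ : ℝ) (P : S → A → S → ℝ) (π : S → A → ℝ) (ρ : S → ℝ) : ℝ :=
  Vval γ P π ρ (fun s a => -Real.log (π s a))

/-- Entropy-regularized value function `V_τ^π(ρ)`. -/
noncomputable def Vtau (γ τ : ℝ) (P : S → A → S → ℝ) (π : S → A → ℝ) (ρ : S → ℝ)
    (c : S → A → ℝ) : ℝ := Vval γ P π ρ c + τ * Hent γ P π ρ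

/-- Euclidean norm of a vector indexed by state-action pairs. -/
noncomputable def polNorm2 (x : S → A → ℝ) : ℝ := Real.sqrt (∑ s, ∑ a, (x s a) ^ 2)

/-- Euclidean norm of a vector in `ℝ^n`. -/
noncomputable def vecNorm2 {n : ℕ} (x : Fin n → ℝ) : ℝ := Real.sqrt (∑ i, (x i) ^ 2)

/-- The soft-max policy associated with parameter `θ`. -/
noncomputable def softmaxPol (θ : S → A → ℝ) : S → A → ℝ :=
  fun s a => Real.exp (θ s a) / ∑ a', Real.exp (θ s a')

/-- Membership in the soft-max policy class `Π`. -/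
def InSoftmax (π : S → A → ℝ) : Prop := ∃ θ : S → A → ℝ, π = softmaxPol θ

/-- Lagrangian `L(π, λ)` of the entropy-regularized CMDP. -/
noncomputable def Lag (γ τ : ℝ) (P : S → A → S → ℝ) (ρ : S → ℝ) (r : S → A → ℝ)
    {n : ℕ} (g : Fin n → S → A → ℝ) (b : Fin n → ℝ) (π : S → A → ℝ)
    (lam : Fin n → ℝ) : ℝ :=
  Vtau γ τ P π ρ r + ∑ i, lam i * (Vval γ P π ρ (g i) - b i)

/-- Dual function `D(λ) = max_{π ∈ Π} L(π, λ)`. -/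
noncomputable def Dual (γ τ : ℝ) (P : S → A → S → ℝ) (ρ : S → ℝ) (r : S → A → ℝ)
    {n : ℕ} (g : Fin n → S → A → ℝ) (b : Fin n → ℝ) (lam : Fin n → ℝ) : ℝ :=
  sSup ((fun π : S → A → ℝ => Lag γ τ P ρ r g b π lam) '' {π | InSoftmax π})

end CMDP

section GradientAccuracy

variable {S A : Type} [Fintype A]

lemma softmaxPol_pos (θ : S → A → ℝ) (s : S) (a : A) : 0 < softmaxPol θ s a :=
  div_pos (Real.exp_pos _)
    (Finset.sum_pos (fun _ _ => Real.exp_pos _) ⟨a, Finset.mem_univ a⟩)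

lemma sum_softmaxPol_le_one (θ : S → A → ℝ) (s : S) : ∑ a, softmaxPol θ s a ≤ 1 := by
  simp only [softmaxPol, ← Finset.sum_div]
  exact div_self_le_one _

lemma softmaxPol_le_one (θ : S → A → ℝ) (s : S) (a : A) : softmaxPol θ s a ≤ 1 :=
  (Finset.single_le_sum (f := softmaxPol θ s) (fun b _ => (softmaxPol_pos θ s b).le)
    (Finset.mem_univ a)).trans (sum_softmaxPol_le_one θ s)

lemma sub_le_abs_log_sub {x y : ℝ} (hx : 0 < x) (hy : 0 < y) (hx1 : x ≤ 1) :
    x - y ≤ |Real.log x - Real.log y| := by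
  have h1 : Real.log (y / x) ≤ y / x - 1 := Real.log_le_sub_one_of_pos (div_pos hy hx)
  rw [Real.log_div hy.ne' hx.ne'] at h1
  have h2 : x * (y / x) = y := by field_simp
  have h3 : x - y ≤ x * (Real.log x - Real.log y) := by nlinarith
  calc x - y ≤ x * (Real.log x - Real.log y) := h3
    _ ≤ x * |Real.log x - Real.log y| := by gcongr; exact le_abs_self _
    _ ≤ |Real.log x - Real.log y| := mul_le_of_le_one_left (abs_nonneg _) hx1

lemma abs_sub_le_abs_log_sub {x y : ℝ} (hx : 0 < x) (hy : 0 < y) (hx1 : x ≤ 1) (hy1 : y ≤ 1) :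
    |x - y| ≤ |Real.log x - Real.log y| := by
  refine abs_sub_le_iff.2 ⟨sub_le_abs_log_sub hx hy hx1, ?_⟩
  rw [abs_sub_comm]
  exact sub_le_abs_log_sub hy hx hy1

variable [Fintype S]

lemma sum_kernel_push {P : S → A → S → ℝ} (hP : IsKernel P) (μ : S → A → ℝ) :
    ∑ s, ∑ s', ∑ a', μ s' a' * P s' a' s = ∑ s, ∑ a, μ s a := by
  rw [Finset.sum_comm]
  refine Finset.sum_congr rfl fun s' _ => ?_
  rw [Finset.sum_comm]
  refine Finset.sum_congr rfl fun a' _ => ?_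
  rw [← Finset.mul_sum, hP.2, mul_one]

/-- Pushing forward along a transition kernel does not increase the `ℓ¹` distance. -/
lemma sum_abs_kernel_push_sub_le {P : S → A → S → ℝ} (hP : IsKernel P) (μ ν : S → A → ℝ) :
    ∑ s, |∑ s', ∑ a', μ s' a' * P s' a' s - ∑ s', ∑ a', ν s' a' * P s' a' s| ≤
      ∑ s, ∑ a, |μ s a - ν s a| := by
  rw [← sum_kernel_push hP]
  refine Finset.sum_le_sum fun s _ => ?_
  simp only [← Finset.sum_sub_distrib, ← sub_mul]
  refine (Finset.abs_sum_le_sum_abs _ _).trans (Finset.sum_le_sum fun s' _ => ?_)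
  refine (Finset.abs_sum_le_sum_abs _ _).trans (Finset.sum_le_sum fun a' _ => ?_)
  rw [abs_mul, abs_of_nonneg (hP.1 s' a' s)]

/-- Attaching actions drawn from `π` and `π'` to state distributions `m` and `m'` increases the
`ℓ¹` distance by at most the distance between the policies. -/
lemma sum_abs_mul_policy_sub_le {m m' : S → ℝ} {π π' : S → A → ℝ} {δ : ℝ} (hδ : 0 ≤ δ)
    (hm0 : ∀ s, 0 ≤ m' s) (hm1 : ∑ s, m' s ≤ 1)
    (hπ0 : ∀ s a, 0 ≤ π s a) (hπ1 : ∀ s, ∑ a, π s a ≤ 1)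
    (hδ' : ∀ s, ∑ a, |π s a - π' s a| ≤ δ) :
    ∑ s, ∑ a, |m s * π s a - m' s * π' s a| ≤ ∑ s, |m s - m' s| + δ := by
  have key : ∀ s, ∑ a, |m s * π s a - m' s * π' s a| ≤ |m s - m' s| + m' s * δ := by
    intro s
    calc ∑ a, |m s * π s a - m' s * π' s a|
        ≤ ∑ a, (|m s - m' s| * π s a + m' s * |π s a - π' s a|) := by
          refine Finset.sum_le_sum fun a _ => ?_
          have h : m s * π s a - m' s * π' s a
              = (m s - m' s) * π s a + m' s * (π s a - π' s a) := by ring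
          rw [h]
          refine (abs_add_le _ _).trans_eq ?_
          rw [abs_mul, abs_mul, abs_of_nonneg (hπ0 s a), abs_of_nonneg (hm0 s)]
      _ = |m s - m' s| * ∑ a, π s a + m' s * ∑ a, |π s a - π' s a| := by
          rw [Finset.sum_add_distrib, Finset.mul_sum, Finset.mul_sum]
      _ ≤ |m s - m' s| + m' s * δ :=
          add_le_add (mul_le_of_le_one_right (abs_nonneg _) (hπ1 s))
            (mul_le_mul_of_nonneg_left (hδ' s) (hm0 s))
  refine (Finset.sum_le_sum fun s _ => key s).trans ?_
  rw [Finset.sum_add_distrib, ← Finset.sum_mul]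
  exact add_le_add_right (mul_le_of_le_one_left hδ hm1) _

lemma sum_mul_policy_le {m : S → ℝ} {π : S → A → ℝ} (hm0 : ∀ s, 0 ≤ m s)
    (hπ1 : ∀ s, ∑ a, π s a ≤ 1) : ∑ s, ∑ a, m s * π s a ≤ ∑ s, m s := by
  refine Finset.sum_le_sum fun s _ => ?_
  rw [← Finset.mul_sum]
  exact mul_le_of_le_one_right (hm0 s) (hπ1 s)

lemma trajSA_nonneg_and_sum_le_one {P : S → A → S → ℝ} (hP : IsKernel P) {ρ : S → ℝ}
    (hρ : IsDist ρ) {π : S → A → ℝ} (hπ0 : ∀ s a, 0 ≤ π s a) (hπ1 : ∀ s, ∑ a, π s a ≤ 1)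
    (t : ℕ) : (∀ s a, 0 ≤ trajSA P π (initSA ρ π) t s a) ∧
      ∑ s, ∑ a, trajSA P π (initSA ρ π) t s a ≤ 1 := by
  induction t with
  | zero =>
    exact ⟨fun s a => mul_nonneg (hρ.1 s) (hπ0 s a),
      (sum_mul_policy_le hρ.1 hπ1).trans_eq hρ.2⟩
  | succ t ih =>
    have hm : ∀ s, 0 ≤ ∑ s', ∑ a', trajSA P π (initSA ρ π) t s' a' * P s' a' s := fun s =>
      Finset.sum_nonneg fun s' _ => Finset.sum_nonneg fun a' _ =>
        mul_nonneg (ih.1 s' a') (hP.1 s' a' s)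
    exact ⟨fun s a => mul_nonneg (hm s) (hπ0 s a),
      (sum_mul_policy_le hm hπ1).trans ((sum_kernel_push hP _).le.trans ih.2)⟩

/-- The `ℓ¹` distance between the state-action distributions of two policies grows at most
linearly in time. -/
lemma sum_abs_trajSA_sub_le {P : S → A → S → ℝ} (hP : IsKernel P) {ρ : S → ℝ}
    (hρ : IsDist ρ) {π π' : S → A → ℝ} {δ : ℝ} (hδ : 0 ≤ δ)
    (hπ0 : ∀ s a, 0 ≤ π s a) (hπ1 : ∀ s, ∑ a, π s a ≤ 1)
    (hπ0' : ∀ s a, 0 ≤ π' s a) (hπ1' : ∀ s, ∑ a, π' s a ≤ 1)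
    (hδ' : ∀ s, ∑ a, |π s a - π' s a| ≤ δ) (t : ℕ) :
    ∑ s, ∑ a, |trajSA P π (initSA ρ π) t s a - trajSA P π' (initSA ρ π') t s a| ≤
      (t + 1) * δ := by
  induction t with
  | zero =>
    refine (sum_abs_mul_policy_sub_le (m := ρ) hδ hρ.1 hρ.2.le hπ0 hπ1 hδ').trans ?_
    simp
  | succ t ih =>
    obtain ⟨h0, h1⟩ := trajSA_nonneg_and_sum_le_one hP hρ hπ0' hπ1' t
    refine (sum_abs_mul_policy_sub_le hδ
      (fun s => Finset.sum_nonneg fun s' _ => Finset.sum_nonneg fun a' _ =>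
        mul_nonneg (h0 s' a') (hP.1 s' a' s))
      ((sum_kernel_push hP _).le.trans h1) hπ0 hπ1 hδ').trans ?_
    have h2 := (sum_abs_kernel_push_sub_le hP (trajSA P π (initSA ρ π) t)
      (trajSA P π' (initSA ρ π') t)).trans ih
    push_cast
    linarith

lemma abs_sum_mul_le_sum_abs {c : S → A → ℝ} (hc : ∀ s a, c s a ∈ Set.Icc (0 : ℝ) 1)
    (μ : S → A → ℝ) : |∑ s, ∑ a, μ s a * c s a| ≤ ∑ s, ∑ a, |μ s a| := by
  refine (Finset.abs_sum_le_sum_abs _ _).trans (Finset.sum_le_sum fun s _ => ?_)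
  refine (Finset.abs_sum_le_sum_abs _ _).trans (Finset.sum_le_sum fun a _ => ?_)
  rw [abs_mul, abs_of_nonneg (hc s a).1]
  exact mul_le_of_le_one_right (abs_nonneg _) (hc s a).2

lemma summable_discounted_trajSA {P : S → A → S → ℝ} (hP : IsKernel P) {ρ : S → ℝ}
    (hρ : IsDist ρ) {π : S → A → ℝ} (hπ0 : ∀ s a, 0 ≤ π s a) (hπ1 : ∀ s, ∑ a, π s a ≤ 1)
    {γ : ℝ} (hγ : γ ∈ Set.Ico (0 : ℝ) 1) {c : S → A → ℝ}
    (hc : ∀ s a, c s a ∈ Set.Icc (0 : ℝ) 1) :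
    Summable fun t : ℕ => γ ^ t * ∑ s, ∑ a, trajSA P π (initSA ρ π) t s a * c s a := by
  refine (summable_geometric_of_lt_one hγ.1 hγ.2).of_norm_bounded fun t => ?_
  obtain ⟨h0, h1⟩ := trajSA_nonneg_and_sum_le_one hP hρ hπ0 hπ1 t
  rw [Real.norm_eq_abs, abs_mul, abs_of_nonneg (pow_nonneg hγ.1 t)]
  refine mul_le_of_le_one_right (pow_nonneg hγ.1 t) ((abs_sum_mul_le_sum_abs hc _).trans ?_)
  simpa only [abs_of_nonneg (h0 _ _)] using h1

lemma hasSum_pow_mul_succ {γ : ℝ} (hγ : γ ∈ Set.Ico (0 : ℝ) 1) :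
    HasSum (fun t : ℕ => γ ^ t * ((t : ℝ) + 1)) (1 / (1 - γ) ^ 2) := by
  have hn : ‖γ‖ < 1 := by rw [Real.norm_eq_abs, abs_of_nonneg hγ.1]; exact hγ.2
  have h := (hasSum_coe_mul_geometric_of_norm_lt_one hn).add
    (hasSum_geometric_of_lt_one hγ.1 hγ.2)
  have h1 : (1 - γ) ≠ 0 := by linarith [hγ.2]
  have e : γ / (1 - γ) ^ 2 + (1 - γ)⁻¹ = 1 / (1 - γ) ^ 2 := by
    field_simp
    ring
  rw [e] at h
  refine h.congr_fun ?_
  intro t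
  ring

/-- Values are Lipschitz in the policy, measured in the row-wise `ℓ¹` distance. -/
lemma abs_Vval_sub_le {P : S → A → S → ℝ} (hP : IsKernel P) {ρ : S → ℝ}
    (hρ : IsDist ρ) {π π' : S → A → ℝ} {δ : ℝ} (hδ : 0 ≤ δ)
    (hπ0 : ∀ s a, 0 ≤ π s a) (hπ1 : ∀ s, ∑ a, π s a ≤ 1)
    (hπ0' : ∀ s a, 0 ≤ π' s a) (hπ1' : ∀ s, ∑ a, π' s a ≤ 1)
    (hδ' : ∀ s, ∑ a, |π s a - π' s a| ≤ δ)
    {γ : ℝ} (hγ : γ ∈ Set.Ico (0 : ℝ) 1) {c : S → A → ℝ}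
    (hc : ∀ s a, c s a ∈ Set.Icc (0 : ℝ) 1) :
    |Vval γ P π ρ c - Vval γ P π' ρ c| ≤ δ / (1 - γ) ^ 2 := by
  have hb := (hasSum_pow_mul_succ hγ).mul_right δ
  rw [one_div_mul_eq_div] at hb
  rw [Vval, Vval, dsum, dsum, ← (summable_discounted_trajSA hP hρ hπ0 hπ1 hγ hc).tsum_sub
    (summable_discounted_trajSA hP hρ hπ0' hπ1' hγ hc), ← Real.norm_eq_abs]
  refine tsum_of_norm_bounded hb fun t => ?_
  rw [← mul_sub, Real.norm_eq_abs, abs_mul, abs_of_nonneg (pow_nonneg hγ.1 t), mul_assoc]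
  refine mul_le_mul_of_nonneg_left ?_ (pow_nonneg hγ.1 t)
  simp only [← Finset.sum_sub_distrib, ← sub_mul]
  exact (abs_sum_mul_le_sum_abs hc _).trans
    (sum_abs_trajSA_sub_le hP hρ hδ hπ0 hπ1 hπ0' hπ1' hδ' t)

lemma vecNorm2_le_sqrt_mul {n : ℕ} {x : Fin n → ℝ} {C : ℝ} (hC : 0 ≤ C)
    (hx : ∀ i, |x i| ≤ C) : vecNorm2 x ≤ Real.sqrt n * C := by
  refine Real.sqrt_le_iff.2 ⟨by positivity, ?_⟩
  rw [mul_pow, Real.sq_sqrt n.cast_nonneg]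
  calc ∑ i, x i ^ 2 ≤ ∑ _i : Fin n, C ^ 2 :=
        Finset.sum_le_sum fun i _ => sq_le_sq' (abs_le.1 (hx i)).1 (abs_le.1 (hx i)).2
    _ = n * C ^ 2 := by simp

end GradientAccuracy

/-- Proposition 4, accuracy of the gradient estimator: if
`‖log π − log π_λ‖_∞ ≤ ε` then the estimator `∇̃D(λ) = (U_{g_i}^π(ρ) − b_i)_i` satisfies
`‖∇̃D(λ) − ∇D(λ)‖₂ ≤ √n·|A|·ε/(1−γ)²`. -/
theorem gradient_estimator_accuracy
    {S A : Type} [Fintype S] [Fintype A]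
    (P : S → A → S → ℝ) (r : S → A → ℝ) (γ τ : ℝ) (ρ : S → ℝ) {n : ℕ}
    (g : Fin n → S → A → ℝ) (b : Fin n → ℝ)
    (hP : IsKernel P) (hr : ∀ s a, r s a ∈ Set.Icc (0 : ℝ) 1)
    (hγ : γ ∈ Set.Ico (0 : ℝ) 1) (hρ : IsDist ρ) (hτ : 0 < τ)
    (hg : ∀ i s a, g i s a ∈ Set.Icc (0 : ℝ) 1)
    (hb : ∀ i, b i ∈ Set.Icc (0 : ℝ) (1 / (1 - γ)))
    -- exploration assumption
    (d : ℝ) (hd : 0 < d)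
    (hexp : ∀ π : S → A → ℝ, InSoftmax π → ∀ s, d ≤ visit γ P π ρ s)
    -- `π_λ` is a maximizer of `L(·,λ)` over `Π`
    (lam : Fin n → ℝ) (hlam : ∀ i, 0 ≤ lam i)
    (πlam : S → A → ℝ) (hlamIn : InSoftmax πlam)
    (hlamopt : ∀ π' : S → A → ℝ, InSoftmax π' →
      Lag γ τ P ρ r g b π' lam ≤ Lag γ τ P ρ r g b πlam lam)
    -- `π ∈ Π` is an `ε`-accurate approximation of `π_λ` in log scale
    (π : S → A → ℝ) (hπ : InSoftmax π) (ε : ℝ)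
    (hlog : ∀ s a, |Real.log (π s a) - Real.log (πlam s a)| ≤ ε) :
    vecNorm2 (fun i => (Vval γ P π ρ (g i) - b i) - (Vval γ P πlam ρ (g i) - b i)) ≤
      Real.sqrt n * Fintype.card A * ε / (1 - γ) ^ 2 := by
  obtain ⟨θ', rfl⟩ := hlamIn
  obtain ⟨θ, rfl⟩ := hπ
  have hdist : ∀ s, ∑ a, |softmaxPol θ s a - softmaxPol θ' s a| ≤ Fintype.card A * ε := by
    intro s
    calc ∑ a, |softmaxPol θ s a - softmaxPol θ' s a| ≤ ∑ _a : A, ε :=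
          Finset.sum_le_sum fun a _ =>
            (abs_sub_le_abs_log_sub (softmaxPol_pos θ s a) (softmaxPol_pos θ' s a)
              (softmaxPol_le_one θ s a) (softmaxPol_le_one θ' s a)).trans (hlog s a)
      _ = Fintype.card A * ε := by simp
  have hS : Nonempty S := by
    by_contra h
    rw [not_nonempty_iff] at h
    simpa using hρ.2
  have hδ : 0 ≤ Fintype.card A * ε :=
    (Finset.sum_nonneg fun _ _ => abs_nonneg _).trans (hdist hS.some)
  rw [mul_assoc, mul_div_assoc]
  refine vecNorm2_le_sqrt_mul (by positivity) fun i => ?_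
  rw [sub_sub_sub_cancel_right]
  exact abs_Vval_sub_le hP hρ hδ (fun s a => (softmaxPol_pos θ s a).le)
    (sum_softmaxPol_le_one θ) (fun s a => (softmaxPol_pos θ' s a).le)
    (sum_softmaxPol_le_one θ') hdist hγ (hg i)
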